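/- Let P₁, P₂, Q be plane posets and σ : P₁ ≀ P₂ → Q a bijection, where P₁ ≀ P₂ is the h-product (all elements of P₁ are <_h all elements of P₂). Set I = σ(P₂). Then σ ∈ S'(P₁ ≀ P₂, Q) if and only if I is a biideal of Q (i.e., both an h-ideal and an r-ideal) and σ|_{P₁} ∈ S'(P₁, Q∖I), σ|_{P₂} ∈ S'(P₂, I). -/

import Mathlib

/-- A plane poset: a finite set with two partial orders `leh` and `ler` such that
two distinct elements are comparable for `leh` iff they are not comparable for `ler`. -/
structure PlanePoset (α : Type) where
  leh : α → α → Prop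
  ler : α → α → Prop
  leh_refl : ∀ x, leh x x
  leh_antisymm : ∀ ⦃x y⦄, leh x y → leh y x → x = y
  leh_trans : ∀ ⦃x y z⦄, leh x y → leh y z → leh x z
  ler_refl : ∀ x, ler x x
  ler_antisymm : ∀ ⦃x y⦄, ler x y → ler y x → x = y
  ler_trans : ∀ ⦃x y z⦄, ler x y → ler y z → ler x z
  compat : ∀ x y, x ≠ y → ((leh x y ∨ leh y x) ↔ ¬(ler x y ∨ ler y x))

/-- The induced total order of a plane poset: `x ≤ y` iff `x ≤ₕ y` or `x ≤ᵣ y`. -/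
def PlanePoset.le {α : Type} (P : PlanePoset α) (x y : α) : Prop :=
  P.leh x y ∨ P.ler x y

/-- The h-product `P₁ ≀ P₂`: disjoint union, every element of `P₁` being `<ₕ`
every element of `P₂`. -/
def PlanePoset.hprod {α β : Type} (P₁ : PlanePoset α) (P₂ : PlanePoset β) :
    PlanePoset (α ⊕ β) where
  leh x y := match x, y with
    | Sum.inl a, Sum.inl b => P₁.leh a b
    | Sum.inr a, Sum.inr b => P₂.leh a b
    | Sum.inl _, Sum.inr _ => True
    | Sum.inr _, Sum.inl _ => False
  ler x y := match x, y with
    | Sum.inl a, Sum.inl b => P₁.ler a b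
    | Sum.inr a, Sum.inr b => P₂.ler a b
    | _, _ => False
  leh_refl x := by cases x with
    | inl a => exact P₁.leh_refl a
    | inr b => exact P₂.leh_refl b
  leh_antisymm x y := by
    cases x <;> cases y <;> intro h1 h2 <;> simp_all <;>
      first
        | exact P₁.leh_antisymm h1 h2
        | exact P₂.leh_antisymm h1 h2
  leh_trans x y z := by
    cases x <;> cases y <;> cases z <;> intro h1 h2 <;> simp_all <;>
      first
        | exact P₁.leh_trans h1 h2
        | exact P₂.leh_trans h1 h2
  ler_refl x := by cases x with
    | inl a => exact P₁.ler_refl a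
    | inr b => exact P₂.ler_refl b
  ler_antisymm x y := by
    cases x <;> cases y <;> intro h1 h2 <;> simp_all <;>
      first
        | exact P₁.ler_antisymm h1 h2
        | exact P₂.ler_antisymm h1 h2
  ler_trans x y z := by
    cases x <;> cases y <;> cases z <;> intro h1 h2 <;> simp_all <;>
      first
        | exact P₁.ler_trans h1 h2
        | exact P₂.ler_trans h1 h2
  compat x y hxy := by
    cases x with
    | inl a => cases y with
      | inl b => exact P₁.compat a b (fun h => hxy (congrArg Sum.inl h))
      | inr b => exact (by tauto : (True ∨ False) ↔ ¬(False ∨ False))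
    | inr a => cases y with
      | inl b => exact (by tauto : (False ∨ True) ↔ ¬(False ∨ False))
      | inr b => exact P₂.compat a b (fun h => hxy (congrArg Sum.inr h))

theorem PlanePoset.le_antisymm {α : Type} (P : PlanePoset α) {x y : α}
    (hxy : P.le x y) (hyx : P.le y x) : x = y := by
  by_contra hne
  have hc := P.compat x y hne
  rcases hxy with h | h <;> rcases hyx with h' | h'
  · exact hne (P.leh_antisymm h h')
  · exact hc.1 (Or.inl h) (Or.inr h')
  · exact hc.1 (Or.inr h') (Or.inl h)
  · exact hne (P.ler_antisymm h h')

theorem PlanePoset.le_total {α : Type} (P : PlanePoset α) (x y : α) :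
    P.le x y ∨ P.le y x := by
  by_cases hxy : x = y
  · subst hxy
    exact Or.inl (Or.inl (P.leh_refl x))
  · have hc := P.compat x y hxy
    unfold PlanePoset.le
    tauto

/-- `σ ∈ S'(P₁ ≀ P₂, Q)` iff `I = σ(P₂)` is a biideal of `Q` and the
restrictions of `σ` to `P₁` and `P₂` lie in `S'(P₁, Q∖I)` and `S'(P₂, I)`. -/
theorem stmt18 {α β γ : Type} [Fintype α] [Fintype β] [Fintype γ]
    (P₁ : PlanePoset α) (P₂ : PlanePoset β) (Q : PlanePoset γ)
    (σ : (α ⊕ β) ≃ γ) :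
    ((∀ x y : α ⊕ β, (P₁.hprod P₂).leh x y → Q.le (σ x) (σ y)) ∧
     (∀ x y : α ⊕ β, Q.leh (σ x) (σ y) → (P₁.hprod P₂).le x y)) ↔
      ((∀ x, x ∈ Set.range (fun b => σ (Sum.inr b)) → ∀ y, Q.le x y →
          y ∈ Set.range (fun b => σ (Sum.inr b))) ∧
       ((∀ x y : α, P₁.leh x y → Q.le (σ (Sum.inl x)) (σ (Sum.inl y))) ∧
        (∀ x y : α, Q.leh (σ (Sum.inl x)) (σ (Sum.inl y)) → P₁.le x y)) ∧
       ((∀ x y : β, P₂.leh x y → Q.le (σ (Sum.inr x)) (σ (Sum.inr y))) ∧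
        (∀ x y : β, Q.leh (σ (Sum.inr x)) (σ (Sum.inr y)) → P₂.le x y))) := by
  constructor
  · rintro ⟨h₁, h₂⟩
    refine ⟨?_, ⟨fun x y => h₁ (.inl x) (.inl y), fun x y => h₂ (.inl x) (.inl y)⟩,
      fun x y => h₁ (.inr x) (.inr y), fun x y => h₂ (.inr x) (.inr y)⟩
    rintro _ ⟨b, rfl⟩ y hy
    obtain ⟨a | b', rfl⟩ := σ.surjective y
    · have hab : Q.le (σ (.inl a)) (σ (.inr b)) := h₁ (.inl a) (.inr b) trivial
      exact absurd (σ.injective (Q.le_antisymm hab hy)) Sum.inl_ne_inr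
    · exact ⟨b', rfl⟩
  · rintro ⟨hI, ⟨hα₁, hα₂⟩, hβ₁, hβ₂⟩
    have not_le (a : α) (b : β) : ¬ Q.le (σ (.inr b)) (σ (.inl a)) := fun h => by
      obtain ⟨b', hb'⟩ := hI _ ⟨b, rfl⟩ _ h
      exact Sum.inr_ne_inl (σ.injective hb')
    constructor
    · rintro (a | b) (a' | b') h
      · exact hα₁ a a' h
      · exact (Q.le_total _ _).resolve_right (not_le a b')
      · exact h.elim
      · exact hβ₁ b b' h
    · rintro (a | b) (a' | b') h
      · exact hα₂ a a' h
      · exact Or.inl trivial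
      · exact (not_le a' b (Or.inl h)).elim
      · exact hβ₂ b b' h
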